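/- If the 4×4 matrix A (as defined) is positive semidefinite and all four quantities y₁ := 2Re(x·ȳ·t), y₂ := 2Re(x·u·z̄), y₃ := 2Re(y·w·z̄), y₄ := 2Re(t·w·ū) are nonnegative, then [per(A)]² ≥ per(A∘Ā), where Ā is the entrywise complex conjugate of A and A∘Ā is the Hadamard (entrywise) product. -/

import Mathlib

open Matrix Complex ComplexOrder

/-- Expansion of a permanent along its first column. -/
theorem permanent_succ_column_zero {R : Type*} [CommSemiring R] {n : ℕ}
    (M : Matrix (Fin (n + 1)) (Fin (n + 1)) R) :
    M.permanent =
      ∑ i, M i 0 * (M.submatrix (fun j => Equiv.swap 0 i j.succ) Fin.succ).permanent := by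
  simp only [permanent, Finset.mul_sum]
  rw [← Equiv.Perm.decomposeFin.symm.sum_comp, Fintype.sum_prod_type]
  simp [Fin.prod_univ_succ, Equiv.Perm.decomposeFin_symm_apply_succ]

theorem permanent_fin_three {R : Type*} [CommSemiring R] (M : Matrix (Fin 3) (Fin 3) R) :
    M.permanent =
      M 0 0 * (M 1 1 * M 2 2 + M 1 2 * M 2 1) + M 0 1 * (M 1 0 * M 2 2 + M 1 2 * M 2 0) +
        M 0 2 * (M 1 0 * M 2 1 + M 1 1 * M 2 0) := by
  simp only [permanent_succ_column_zero, Fin.sum_univ_succ, permanent_unique, submatrix_apply,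
    Finset.univ_eq_empty, Finset.sum_empty]
  simp [Equiv.swap_apply_def]
  ring

theorem permanent_fin_four {R : Type*} [CommSemiring R] (M : Matrix (Fin 4) (Fin 4) R) :
    M.permanent =
      M 0 0 * (M 1 1 * (M 2 2 * M 3 3 + M 2 3 * M 3 2) + M 1 2 * (M 2 1 * M 3 3 + M 2 3 * M 3 1) +
        M 1 3 * (M 2 1 * M 3 2 + M 2 2 * M 3 1)) +
      M 0 1 * (M 1 0 * (M 2 2 * M 3 3 + M 2 3 * M 3 2) + M 1 2 * (M 2 0 * M 3 3 + M 2 3 * M 3 0) +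
        M 1 3 * (M 2 0 * M 3 2 + M 2 2 * M 3 0)) +
      M 0 2 * (M 1 0 * (M 2 1 * M 3 3 + M 2 3 * M 3 1) + M 1 1 * (M 2 0 * M 3 3 + M 2 3 * M 3 0) +
        M 1 3 * (M 2 0 * M 3 1 + M 2 1 * M 3 0)) +
      M 0 3 * (M 1 0 * (M 2 1 * M 3 2 + M 2 2 * M 3 1) + M 1 1 * (M 2 0 * M 3 2 + M 2 2 * M 3 0) +
        M 1 2 * (M 2 0 * M 3 1 + M 2 1 * M 3 0)) := by
  simp only [permanent_succ_column_zero M, permanent_fin_three, submatrix_apply]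
  simp [Fin.sum_univ_succ, Equiv.swap_apply_def]
  ring

/-- The modulus of an entry of a correlation matrix is at most one. -/
theorem normSq_le_one_of_posSemidef {n : Type*} [Finite n] {A : Matrix n n ℂ}
    (hA : A.PosSemidef) (hdiag : ∀ i, A i i = 1) (i j : n) : normSq (A i j) ≤ 1 := by
  have hdet := (hA.submatrix ![i, j]).det_nonneg
  have hji : A j i = starRingEnd ℂ (A i j) := (hA.1.apply j i).symm
  rw [det_fin_two] at hdet
  simp only [submatrix_apply, cons_val_zero, cons_val_one, hdiag, hji, mul_conj] at hdet
  have : (0 : ℝ) ≤ 1 * 1 - normSq (A i j) := by exact_mod_cast hdet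
  linarith

/-- Nonnegativity of a `3 × 3` principal minor of a correlation matrix. -/
theorem normSq_add_le_of_posSemidef {n : Type*} [Finite n] {A : Matrix n n ℂ}
    (hA : A.PosSemidef) (hdiag : ∀ i, A i i = 1) (i j k : n) :
    normSq (A i j) + normSq (A i k) + normSq (A j k) ≤
      1 + 2 * (A i j * A j k * starRingEnd ℂ (A i k)).re := by
  have hdet := (hA.submatrix ![i, j, k]).det_nonneg
  have hji : A j i = starRingEnd ℂ (A i j) := (hA.1.apply j i).symm
  have hki : A k i = starRingEnd ℂ (A i k) := (hA.1.apply k i).symm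
  have hkj : A k j = starRingEnd ℂ (A j k) := (hA.1.apply k j).symm
  have hre := (Complex.le_def.1 hdet).1
  rw [det_fin_three] at hre
  simp [hdiag, hji, hki, hkj] at hre
  simp only [normSq_apply, mul_re, mul_im, conj_re, conj_im]
  nlinarith [hre]

/-- Here `s` plays the role of the sum of the squared moduli above the diagonal, `v` the sum of
the `3`-cycle terms of the permanent, and `m` the sum of the double transposition and `4`-cycle
terms. -/
theorem sq_lower_bound {s v m : ℝ} (hs0 : 0 ≤ s) (hs6 : s ≤ 6) (hv0 : 0 ≤ v)
    (hv : 2 * s - 4 ≤ v) (hm : -(s ^ 2 / 12) ≤ m) :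
    1 + 5 / 4 * s ^ 2 ≤ (1 + s + v + m) ^ 2 := by
  rcases le_total s 2 with h | h
  · have h1 : 1 + 5 / 6 * s ≤ 1 + s + v + m := by nlinarith
    have h2 : (1 + 5 / 6 * s) ^ 2 ≤ (1 + s + v + m) ^ 2 := by gcongr
    nlinarith
  · have h1 : (7 * s - 6) / 3 ≤ 1 + s + v + m := by nlinarith
    have h2 : ((7 * s - 6) / 3) ^ 2 ≤ (1 + s + v + m) ^ 2 := by
      apply pow_le_pow_left₀ _ h1
      linarith
    nlinarith

theorem hadamard_upper_bound {a b c d e f : ℝ}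
    (ha : 0 ≤ a) (hb : 0 ≤ b) (hc : 0 ≤ c) (hd : 0 ≤ d) (he : 0 ≤ e) (hf : 0 ≤ f)
    (ha1 : a ≤ 1) (hb1 : b ≤ 1) (hc1 : c ≤ 1) (hd1 : d ≤ 1) (he1 : e ≤ 1) (hf1 : f ≤ 1) :
    a ^ 2 + b ^ 2 + c ^ 2 + d ^ 2 + e ^ 2 + f ^ 2 +
        2 * (a * b * d + a * e * c + b * f * c + d * f * e) + (a * f + b * e + c * d) ^ 2 ≤
      5 / 4 * (a + b + c + d + e + f) ^ 2 := by
  have triple {p q r : ℝ} (hp : 0 ≤ p) (hq : 0 ≤ q) (hr : r ≤ 1) : p * q * r ≤ p * q :=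
    mul_le_of_le_one_right (mul_nonneg hp hq) hr
  have pair {p q : ℝ} (hp : 0 ≤ p) (hp1 : p ≤ 1) (hq : 0 ≤ q) (hq1 : q ≤ 1) :
      p * q ≤ (p + q) / 2 := by nlinarith
  have hP : (a * f + b * e + c * d) ^ 2 ≤ ((a + b + c + d + e + f) / 2) ^ 2 := by
    apply pow_le_pow_left₀ (by positivity)
    linarith [pair ha ha1 hf hf1, pair hb hb1 he he1, pair hc hc1 hd hd1]
  have h1 := triple ha hb hd1
  have h2 := triple ha he hc1
  have h3 := triple hb hf hc1
  have h4 := triple hd hf he1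
  have : 0 ≤ a * c + a * d + a * f + b * c + b * d + b * e + c * d + c * e + c * f + d * e +
    e * f := by positivity
  nlinarith

/-- Lower bound for the double transposition and `4`-cycle terms of a permanent in terms of
the products `p, q, r` of the moduli of opposite entries. -/
theorem neg_sq_div_twelve_le {p q r g h k s : ℝ} (hp : 0 ≤ p) (hq : 0 ≤ q) (hr : 0 ≤ r)
    (hs : p + q + r ≤ s / 2) (hg : -(p * r) ≤ g) (hh : -(p * q) ≤ h) (hk : -(q * r) ≤ k) :
    -(s ^ 2 / 12) ≤ p ^ 2 + q ^ 2 + r ^ 2 + (2 * g + 2 * h + 2 * k) := by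
  have : (p + q + r) ^ 2 ≤ (s / 2) ^ 2 := by gcongr
  nlinarith [sq_nonneg (p - q), sq_nonneg (q - r), sq_nonneg (p - r)]

theorem chollet_case_nonneg (x y z t u w : ℂ)
    (A : Matrix (Fin 4) (Fin 4) ℂ)
    (hAdef : A = !![1, x, y, z;
                    (starRingEnd ℂ) x, 1, t, u;
                    (starRingEnd ℂ) y, (starRingEnd ℂ) t, 1, w;
                    (starRingEnd ℂ) z, (starRingEnd ℂ) u, (starRingEnd ℂ) w, 1])
    (hA : A.PosSemidef)
    (hy1 : (0:ℝ) ≤ (2 * (x * (starRingEnd ℂ) y * t).re))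
    (hy2 : (0:ℝ) ≤ (2 * (x * u * (starRingEnd ℂ) z).re))
    (hy3 : (0:ℝ) ≤ (2 * (y * w * (starRingEnd ℂ) z).re))
    (hy4 : (0:ℝ) ≤ (2 * (t * w * (starRingEnd ℂ) u).re)) :
    (A ⊙ A.map (starRingEnd ℂ)).permanent ≤ A.permanent ^ 2 := by
  have hdiag : ∀ i, A i i = 1 := by
    intro i
    fin_cases i <;> simp [hAdef]
  have h01 : A 0 1 = x := by simp [hAdef]
  have h02 : A 0 2 = y := by simp [hAdef]
  have h03 : A 0 3 = z := by simp [hAdef]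
  have h12 : A 1 2 = t := by simp [hAdef]
  have h13 : A 1 3 = u := by simp [hAdef]
  have h23 : A 2 3 = w := by simp [hAdef]
  have hx1 := normSq_le_one_of_posSemidef hA hdiag 0 1
  have hy1' := normSq_le_one_of_posSemidef hA hdiag 0 2
  have hz1 := normSq_le_one_of_posSemidef hA hdiag 0 3
  have ht1 := normSq_le_one_of_posSemidef hA hdiag 1 2
  have hu1 := normSq_le_one_of_posSemidef hA hdiag 1 3
  have hw1 := normSq_le_one_of_posSemidef hA hdiag 2 3
  have hxyt := normSq_add_le_of_posSemidef hA hdiag 0 1 2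
  have hxzu := normSq_add_le_of_posSemidef hA hdiag 0 1 3
  have hyzw := normSq_add_le_of_posSemidef hA hdiag 0 2 3
  have htuw := normSq_add_le_of_posSemidef hA hdiag 1 2 3
  simp only [h01, h02, h03, h12, h13, h23] at *
  rw [mul_right_comm x t] at hxyt
  set s := normSq x + normSq y + normSq z + normSq t + normSq u + normSq w with hs
  set v := 2 * (x * starRingEnd ℂ y * t).re + 2 * (x * u * starRingEnd ℂ z).re +
    2 * (y * w * starRingEnd ℂ z).re + 2 * (t * w * starRingEnd ℂ u).re with hv
  set m := (‖x‖ * ‖w‖) ^ 2 + (‖y‖ * ‖u‖) ^ 2 + (‖z‖ * ‖t‖) ^ 2 +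
    (2 * (x * w * t * starRingEnd ℂ z).re + 2 * (x * starRingEnd ℂ w * u * starRingEnd ℂ y).re +
      2 * (y * u * starRingEnd ℂ t * starRingEnd ℂ z).re) with hm
  have hper : A.permanent = ((1 + s + v + m : ℝ) : ℂ) := by
    rw [permanent_fin_four, hAdef, hs, hv, hm]
    simp only [mul_pow, ← normSq_eq_norm_sq]
    apply Complex.ext
    · simp [normSq_apply]
      ring
    · simp
      ring
  have hper' : (A ⊙ A.map (starRingEnd ℂ)).permanent =
      ((1 + (normSq x ^ 2 + normSq y ^ 2 + normSq z ^ 2 + normSq t ^ 2 + normSq u ^ 2 +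
        normSq w ^ 2 + 2 * (normSq x * normSq y * normSq t + normSq x * normSq u * normSq z +
          normSq y * normSq w * normSq z + normSq t * normSq w * normSq u) +
        (normSq x * normSq w + normSq y * normSq u + normSq z * normSq t) ^ 2) : ℝ) : ℂ) := by
    rw [permanent_fin_four, hAdef]
    simp [mul_conj, mul_comm (starRingEnd ℂ _)]
    ring
  have hsum : ‖x‖ * ‖w‖ + ‖y‖ * ‖u‖ + ‖z‖ * ‖t‖ ≤ s / 2 := by
    simp only [hs, normSq_eq_norm_sq]
    nlinarith [sq_nonneg (‖x‖ - ‖w‖), sq_nonneg (‖y‖ - ‖u‖), sq_nonneg (‖z‖ - ‖t‖)]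
  have hmlow : -(s ^ 2 / 12) ≤ m := by
    apply neg_sq_div_twelve_le (by positivity) (by positivity) (by positivity) hsum
    · have := neg_le_of_abs_le (abs_re_le_norm (x * w * t * starRingEnd ℂ z))
      simp only [norm_mul, RCLike.norm_conj] at this
      linarith
    · have := neg_le_of_abs_le (abs_re_le_norm (x * starRingEnd ℂ w * u * starRingEnd ℂ y))
      simp only [norm_mul, RCLike.norm_conj] at this
      linarith
    · have := neg_le_of_abs_le (abs_re_le_norm (y * u * starRingEnd ℂ t * starRingEnd ℂ z))
      simp only [norm_mul, RCLike.norm_conj] at this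
      linarith
  have hlow : 1 + 5 / 4 * s ^ 2 ≤ (1 + s + v + m) ^ 2 :=
    sq_lower_bound (by simp only [hs, normSq_eq_norm_sq]; positivity) (by linarith) (by linarith)
      (by linarith) hmlow
  have hup := hadamard_upper_bound (normSq_nonneg x) (normSq_nonneg y) (normSq_nonneg z)
    (normSq_nonneg t) (normSq_nonneg u) (normSq_nonneg w) hx1 hy1' hz1 ht1 hu1 hw1
  rw [hper, hper', ← ofReal_pow, real_le_real]
  linarith
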